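/- Let f : (-1,1) → ℝ be measurable with f(x)·(1-x²)^{1/4} ∈ L²(-1,1). If the finite Hilbert transform (Hf)(x) = (1/π) p.v. ∫_{-1}^{1} f(y)/(x-y) dy exists and equals 0 for almost every x ∈ (-1,1), then there exists a constant c ∈ ℝ such that f(x) = c/√(1-x²) for almost every x ∈ (-1,1). -/

import Mathlib

open MeasureTheory Filter Set Real

/-- The truncated finite Hilbert transform of `f` on `(-1,1)` at `x`,
with the symmetric window of radius `ε` around `x` removed. -/
noncomputable def truncatedFiniteHilbert (f : ℝ → ℝ) (x ε : ℝ) : ℝ :=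
  (1 / π) * ∫ y in Ioo (-1 : ℝ) 1 \ Ioo (x - ε) (x + ε), f y / (x - y)

/-- `L` is the value of the finite Hilbert transform
`(Hf)(x) = (1/π) p.v. ∫_{-1}^1 f(y)/(x-y) dy`, defined as a limit as `ε → 0⁺`. -/
def HasFiniteHilbertAt (f : ℝ → ℝ) (x L : ℝ) : Prop :=
  Tendsto (fun ε => truncatedFiniteHilbert f x ε) (nhdsWithin 0 (Ioi 0)) (nhds L)

open scoped Topology

lemma hasDerivAt_neg_inv_one_add_sq (s : ℝ) :
    HasDerivAt (fun s : ℝ => -(1 + s ^ 2)⁻¹) (2 * s / (1 + s ^ 2) ^ 2) s := by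
  have h : (1 + s ^ 2) ≠ 0 := by positivity
  exact (((hasDerivAt_pow 2 s).const_add 1).fun_inv h).fun_neg.congr_deriv (by simp [neg_div])

lemma tendsto_neg_inv_one_add_sq : Tendsto (fun s : ℝ => -(1 + s ^ 2)⁻¹) atTop (𝓝 0) := by
  rw [← neg_zero]
  exact (tendsto_inv_atTop_zero.comp
    (tendsto_atTop_add_const_left _ 1 (tendsto_pow_atTop two_ne_zero))).neg

lemma integrableOn_two_mul_div_one_add_sq_sq :
    IntegrableOn (fun s : ℝ => 2 * s / (1 + s ^ 2) ^ 2) (Ioi 0) :=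
  integrableOn_Ioi_deriv_of_nonneg' (fun s _ => hasDerivAt_neg_inv_one_add_sq s)
    (fun s (hs : 0 < s) => by positivity) tendsto_neg_inv_one_add_sq

/-- The density `2s/(1+s²)²` has mass `t²/(t²+δ²)` on `{s > 0 | δ s ≤ |t|}`. -/
lemma integral_indicator_two_mul_div_one_add_sq_sq {δ : ℝ} (hδ : 0 < δ) (t : ℝ) :
    ∫ s in Ioi (0 : ℝ), {s : ℝ | δ * s ≤ |t|}.indicator (fun s => 2 * s / (1 + s ^ 2) ^ 2) s
      = t ^ 2 / (t ^ 2 + δ ^ 2) := by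
  have hset : Ioi (0 : ℝ) ∩ {s : ℝ | δ * s ≤ |t|} = Ioc 0 (|t| / δ) := by
    ext s
    simp [le_div_iff₀ hδ, mul_comm]
  rw [setIntegral_indicator (measurableSet_le (by fun_prop) (by fun_prop)), hset,
    ← intervalIntegral.integral_of_le (by positivity),
    intervalIntegral.integral_eq_sub_of_hasDerivAt
      (fun s _ => hasDerivAt_neg_inv_one_add_sq s)
      (Continuous.intervalIntegrable
        (by fun_prop (disch := intro x; positivity)) _ _)]
  have : t ^ 2 + δ ^ 2 ≠ 0 := by positivity
  rw [div_pow, sq_abs]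
  have h2 : 1 + t ^ 2 / δ ^ 2 = (t ^ 2 + δ ^ 2) / δ ^ 2 := by field_simp; ring
  rw [h2]
  field_simp
  ring

/-- The regularised Hilbert integral is an average of truncated Hilbert integrals. -/
lemma integral_regularized_eq {f : ℝ → ℝ} (hf : IntegrableOn f (Ioo (-1 : ℝ) 1)) (x : ℝ)
    {δ : ℝ} (hδ : 0 < δ) :
    IntegrableOn
        (fun s => π * truncatedFiniteHilbert f x (δ * s) * (2 * s / (1 + s ^ 2) ^ 2)) (Ioi 0) ∧
      ∫ y in Ioo (-1 : ℝ) 1, f y * ((x - y) / ((x - y) ^ 2 + δ ^ 2)) =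
      ∫ s in Ioi (0 : ℝ), π * truncatedFiniteHilbert f x (δ * s) * (2 * s / (1 + s ^ 2) ^ 2) := by
  set F : ℝ → ℝ → ℝ := fun y s => {s : ℝ | δ * s ≤ |x - y|}.indicator
    (fun s => f y / (x - y) * (2 * s / (1 + s ^ 2) ^ 2)) s with hF
  have hFint : Integrable (Function.uncurry F)
      ((volume.restrict (Ioo (-1 : ℝ) 1)).prod (volume.restrict (Ioi 0))) := by
    have hdom := hf.norm.mul_prod
      (((integrable_inv_one_add_sq).const_mul (2 / δ)).integrableOn (s := Ioi (0 : ℝ)))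
    have hset : MeasurableSet {p : ℝ × ℝ | δ * p.2 ≤ |x - p.1|} :=
      measurableSet_le (by fun_prop) (by fun_prop)
    have hFeq : Function.uncurry F = {p : ℝ × ℝ | δ * p.2 ≤ |x - p.1|}.indicator
        (fun p => f p.1 / (x - p.1) * (2 * p.2 / (1 + p.2 ^ 2) ^ 2)) := by
      ext p
      simp [Function.uncurry, hF, indicator]
    refine hdom.mono ?_ ?_
    · rw [hFeq]
      refine AEStronglyMeasurable.indicator ?_ hset
      refine AEStronglyMeasurable.mul ?_ ?_
      · have h1 : AEStronglyMeasurable (fun p : ℝ × ℝ => f p.1)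
          ((volume.restrict (Ioo (-1 : ℝ) 1)).prod (volume.restrict (Ioi 0))) :=
          hf.aestronglyMeasurable.comp_fst
        have h2 : Measurable (fun p : ℝ × ℝ => (x - p.1)⁻¹) := by fun_prop
        simpa [div_eq_mul_inv] using! h1.mul h2.aestronglyMeasurable
      · exact (Measurable.aestronglyMeasurable (by fun_prop))
    · rw [Measure.prod_restrict]
      filter_upwards [ae_restrict_mem (measurableSet_Ioo.prod measurableSet_Ioi)] with p hp
      have hs : 0 < p.2 := hp.2
      rw [hFeq, indicator]
      split_ifs with h
      · have h : δ * p.2 ≤ |x - p.1| := h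
        have hpos : 0 < δ * p.2 := by positivity
        simp only [norm_mul, norm_div, Real.norm_eq_abs, abs_abs]
        rw [abs_of_pos hs, abs_of_pos hδ, abs_inv, abs_pow,
          abs_of_pos (by positivity : 0 < 1 + p.2 ^ 2),
          abs_two]
        calc |f p.1| / |x - p.1| * (2 * p.2 / (1 + p.2 ^ 2) ^ 2)
            ≤ |f p.1| / (δ * p.2) * (2 * p.2 / (1 + p.2 ^ 2) ^ 2) := by gcongr
          _ = |f p.1| * (2 / δ * ((1 + p.2 ^ 2) ^ 2)⁻¹) := by field_simp
          _ ≤ |f p.1| * (2 / δ * (1 + p.2 ^ 2)⁻¹) := by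
            gcongr
            nlinarith [sq_nonneg p.2]
      · rw [norm_zero]
        positivity
  have hinner : ∀ s, ∫ y in Ioo (-1 : ℝ) 1, F y s =
      π * truncatedFiniteHilbert f x (δ * s) * (2 * s / (1 + s ^ 2) ^ 2) := fun s => by
    have : ∀ y, F y s = (Ioo (x - δ * s) (x + δ * s))ᶜ.indicator
        (fun y => f y / (x - y)) y * (2 * s / (1 + s ^ 2) ^ 2) := fun y => by
      have h : δ * s ≤ |x - y| ↔ y ∈ (Ioo (x - δ * s) (x + δ * s))ᶜ := by
        rw [mem_compl_iff, mem_Ioo, ← not_lt, abs_lt]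
        refine not_congr ⟨fun h => ⟨by linarith, by linarith⟩,
          fun h => ⟨by linarith, by linarith⟩⟩
      simp only [hF, indicator, mem_ofPred_eq, h]
      split_ifs <;> simp
    simp only [this]
    rw [integral_mul_const, setIntegral_indicator measurableSet_Ioo.compl,
      ← sdiff_eq, truncatedFiniteHilbert]
    field_simp
  refine ⟨hFint.swap.integral_prod_left.congr (ae_of_all _ hinner), ?_⟩
  calc ∫ y in Ioo (-1 : ℝ) 1, f y * ((x - y) / ((x - y) ^ 2 + δ ^ 2))
      = ∫ y in Ioo (-1 : ℝ) 1, ∫ s in Ioi (0 : ℝ), F y s := by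
        refine integral_congr_ae (ae_of_all _ fun y => ?_)
        have : ∀ s, F y s = f y / (x - y) * {s : ℝ | δ * s ≤ |x - y|}.indicator
            (fun s => 2 * s / (1 + s ^ 2) ^ 2) s := fun s => by
          simp [hF, indicator]
        simp only [this]
        rw [integral_const_mul, integral_indicator_two_mul_div_one_add_sq_sq hδ]
        rcases eq_or_ne (x - y) 0 with h | h
        · simp [h]
        · field_simp
    _ = ∫ s in Ioi (0 : ℝ), ∫ y in Ioo (-1 : ℝ) 1, F y s := integral_integral_swap hFint
    _ = _ := by simp only [hinner]

/-- Abelian theorem: the regularised Hilbert integral tends to the principal value `0`. -/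
lemma HasFiniteHilbertAt.tendsto_regularized {f : ℝ → ℝ}
    (hf : IntegrableOn f (Ioo (-1 : ℝ) 1)) {x : ℝ} (hx : HasFiniteHilbertAt f x 0) :
    Tendsto (fun δ => ∫ y in Ioo (-1 : ℝ) 1, f y * ((x - y) / ((x - y) ^ 2 + δ ^ 2)))
      (𝓝[>] 0) (𝓝 0) := by
  obtain ⟨M, hM⟩ : ∃ M, ∀ ε > 0, |truncatedFiniteHilbert f x ε| ≤ M := by
    have h1 : ∀ᶠ ε in 𝓝[>] (0 : ℝ), |truncatedFiniteHilbert f x ε| < 1 := by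
      have := hx.abs
      rw [abs_zero] at this
      exact this.eventually_lt_const one_pos
    obtain ⟨e, he, h1⟩ := mem_nhdsGT_iff_exists_Ioo_subset.1 h1
    have he : 0 < e := he
    refine ⟨max 1 (1 / π * ((∫ y in Ioo (-1 : ℝ) 1, |f y|) / e)), fun ε hε => ?_⟩
    rcases lt_or_ge ε e with h | h
    · exact le_max_of_le_left (h1 ⟨hε, h⟩).le
    · refine le_max_of_le_right ?_
      rw [truncatedFiniteHilbert, abs_mul, abs_of_pos (by positivity : 0 < 1 / π)]
      gcongr
      have hmeas : MeasurableSet (Ioo (-1 : ℝ) 1 \ Ioo (x - ε) (x + ε)) :=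
        measurableSet_Ioo.diff measurableSet_Ioo
      calc |∫ y in Ioo (-1 : ℝ) 1 \ Ioo (x - ε) (x + ε), f y / (x - y)|
          ≤ ∫ y in Ioo (-1 : ℝ) 1 \ Ioo (x - ε) (x + ε), |f y| / e := by
            rw [← Real.norm_eq_abs]
            refine norm_integral_le_of_norm_le ((hf.mono_set sdiff_subset).abs.div_const e) ?_
            filter_upwards [ae_restrict_mem hmeas] with y hy
            rw [norm_div, Real.norm_eq_abs, Real.norm_eq_abs]
            gcongr
            refine h.trans ?_
            by_contra! hlt
            rw [abs_lt] at hlt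
            exact hy.2 ⟨by linarith, by linarith⟩
        _ ≤ ∫ y in Ioo (-1 : ℝ) 1, |f y| / e :=
            setIntegral_mono_set (hf.abs.div_const e) (ae_of_all _ fun y => by
              simp only [Pi.zero_apply]; positivity)
              (LE.le.eventuallyLE sdiff_subset)
        _ = (∫ y in Ioo (-1 : ℝ) 1, |f y|) / e := integral_div _ _
  have hlim : Tendsto (fun δ => ∫ s in Ioi (0 : ℝ),
      π * truncatedFiniteHilbert f x (δ * s) * (2 * s / (1 + s ^ 2) ^ 2)) (𝓝[>] 0)
      (𝓝 (∫ s in Ioi (0 : ℝ), (0 : ℝ))) := by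
    refine tendsto_integral_filter_of_dominated_convergence
      (fun s => π * M * (2 * s / (1 + s ^ 2) ^ 2)) ?_ ?_
      (integrableOn_two_mul_div_one_add_sq_sq.const_mul _) ?_
    · filter_upwards [self_mem_nhdsWithin] with δ hδ
      exact (integral_regularized_eq hf x hδ).1.aestronglyMeasurable
    · filter_upwards [self_mem_nhdsWithin] with δ (hδ : 0 < δ)
      filter_upwards [ae_restrict_mem measurableSet_Ioi] with s (hs : 0 < s)
      rw [norm_mul, norm_mul, Real.norm_of_nonneg pi_pos.le,
        Real.norm_of_nonneg (by positivity : 0 ≤ 2 * s / (1 + s ^ 2) ^ 2)]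
      gcongr
      exact hM _ (by positivity)
    · filter_upwards [ae_restrict_mem measurableSet_Ioi] with s (hs : 0 < s)
      have hδs : Tendsto (fun δ => δ * s) (𝓝[>] 0) (𝓝[>] 0) := by
        refine tendsto_nhdsWithin_iff.2 ⟨?_, ?_⟩
        · refine Tendsto.mono_left ?_ nhdsWithin_le_nhds
          simpa using! (continuous_mul_const s).tendsto 0
        · filter_upwards [self_mem_nhdsWithin] with δ (hδ : 0 < δ)
          exact mul_pos hδ hs
      simpa using! ((Tendsto.comp hx hδs).const_mul π).mul_const (2 * s / (1 + s ^ 2) ^ 2)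
  rw [integral_zero] at hlim
  refine hlim.congr' ?_
  filter_upwards [self_mem_nhdsWithin] with δ hδ
  exact (integral_regularized_eq hf x hδ).2.symm

lemma hasSum_pow_mul_sin_mul_cos {r : ℝ} (h0 : 0 < r) (h1 : r < 1) {θ : ℝ} (hs : 0 < sin θ)
    (φ : ℝ) :
    HasSum (fun n : ℕ => r ^ n * sin (n * θ) * cos (n * φ))
      (r * sin θ * ((1 + r ^ 2) * cos φ - 2 * r * cos θ) /
        (((1 + r ^ 2) * cos θ - 2 * r * cos φ) ^ 2 + (1 - r ^ 2) ^ 2 * sin θ ^ 2)) := by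
  have key : ∀ α : ℝ, HasSum (fun n : ℕ => r ^ n * sin (n * α))
      (r * sin α / (1 - 2 * r * cos α + r ^ 2)) := fun α => by
    have hn : ‖(r : ℂ) * Complex.exp (α * Complex.I)‖ < 1 := by
      rw [norm_mul, Complex.norm_exp_ofReal_mul_I, mul_one, Complex.norm_real,
        Real.norm_of_nonneg h0.le]
      exact h1
    have h := Complex.hasSum_im (hasSum_geometric_of_norm_lt_one hn)
    convert h using 1
    · ext n
      rw [mul_pow, ← Complex.exp_nat_mul, ← mul_assoc, ← Complex.ofReal_pow, Complex.im_ofReal_mul,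
        show (n : ℂ) * α = ((n * α : ℝ) : ℂ) by push_cast; rfl, Complex.exp_ofReal_mul_I_im]
    · rw [Complex.inv_im, Complex.normSq_apply]
      simp only [Complex.sub_im, Complex.sub_re, Complex.one_im, Complex.one_re,
        Complex.re_ofReal_mul, Complex.im_ofReal_mul, Complex.exp_ofReal_mul_I_im,
        Complex.exp_ofReal_mul_I_re]
      congr 1
      · ring
      · linear_combination - r ^ 2 * sin_sq_add_cos_sq α
  have h := ((key (θ + φ)).add (key (θ - φ))).div_const 2
  have hpos : ∀ α : ℝ, 0 < 1 - 2 * r * cos α + r ^ 2 := fun α => by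
    nlinarith [cos_le_one α, mul_nonneg h0.le (sub_nonneg.2 (cos_le_one α)),
      pow_pos (sub_pos.2 h1) 2]
  convert! h using 1
  · ext n
    rw [mul_add, mul_sub, sin_add, sin_sub]
    ring
  · have hD : 0 < ((1 + r ^ 2) * cos θ - 2 * r * cos φ) ^ 2 + (1 - r ^ 2) ^ 2 * sin θ ^ 2 := by
      have : 0 < 1 - r ^ 2 := by nlinarith
      positivity
    have h1 := hpos (θ + φ)
    have h2 := hpos (θ - φ)
    have hmul : (1 - 2 * r * cos (θ + φ) + r ^ 2) * (1 - 2 * r * cos (θ - φ) + r ^ 2) =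
        ((1 + r ^ 2) * cos θ - 2 * r * cos φ) ^ 2 + (1 - r ^ 2) ^ 2 * sin θ ^ 2 := by
      rw [cos_add, cos_sub]
      have e1 := sin_sq θ
      have e2 := sin_sq φ
      ring_nf
      simp only [e1, e2]
      ring
    rw [div_add_div _ _ h1.ne' h2.ne', hmul, div_div, div_eq_div_iff hD.ne' (by positivity),
      sin_add, sin_sub, cos_add, cos_sub]
    have e2 := sin_sq φ
    linear_combination (4 * r ^ 2 * sin θ * cos θ *
      (((1 + r ^ 2) * cos θ - 2 * r * cos φ) ^ 2 + (1 - r ^ 2) ^ 2 * sin θ ^ 2)) * e2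

/-- The difference between the conjugate Poisson type kernel and the regularised Hilbert kernel
is bounded uniformly in the radius. -/
lemma abs_kernel_add_le {r s x y : ℝ} (h0 : 0 < r) (h1 : r < 1) (hs : 0 < s) (hx : |x| ≤ 1)
    (hy : |y| ≤ 1) :
    |r * s * ((1 + r ^ 2) * y - 2 * r * x) /
        (((1 + r ^ 2) * x - 2 * r * y) ^ 2 + (1 - r ^ 2) ^ 2 * s ^ 2) +
      s / 2 * ((x - y) / ((x - y) ^ 2 + ((1 - r ^ 2) * s / (2 * r)) ^ 2))| ≤ 3 / s := by
  have hr2 : 0 < 1 - r ^ 2 := by nlinarith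
  obtain ⟨t, ht⟩ : ∃ t, t = 2 * r * (x - y) := ⟨_, rfl⟩
  obtain ⟨v, hv⟩ : ∃ v, v = (1 + r ^ 2) * x - 2 * r * y := ⟨_, rfl⟩
  set N := (1 - r ^ 2) ^ 2 * s ^ 2 with hN
  have hNpos : 0 < N := by positivity
  have e1 : s / 2 * ((x - y) / ((x - y) ^ 2 + ((1 - r ^ 2) * s / (2 * r)) ^ 2)) =
      r * s * (t / (t ^ 2 + N)) := by
    have : (x - y) ^ 2 + ((1 - r ^ 2) * s / (2 * r)) ^ 2 = (t ^ 2 + N) / (4 * r ^ 2) := by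
      rw [ht, hN]; field_simp; ring
    rw [this, ht]
    field_simp
    ring
  have e2 : (1 + r ^ 2) * y - 2 * r * x = (1 - r) ^ 2 * y - t := by rw [ht]; ring
  have e3 : v - t = (1 - r) ^ 2 * x := by rw [ht, hv]; ring
  rw [e1, ← hv, e2]
  have e4 : r * s * ((1 - r) ^ 2 * y - t) / (v ^ 2 + N) + r * s * (t / (t ^ 2 + N)) =
      r * s * ((1 - r) ^ 2 *
        (y / (v ^ 2 + N) + x * (t * (v + t) / ((v ^ 2 + N) * (t ^ 2 + N))))) := by
    have : t / (t ^ 2 + N) - t / (v ^ 2 + N) =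
        (v - t) * (t * (v + t)) / ((v ^ 2 + N) * (t ^ 2 + N)) := by
      field_simp; ring
    rw [e3] at this
    linear_combination (r * s) * this
  have b1 : |y / (v ^ 2 + N)| ≤ 1 / N := by
    rw [abs_div, abs_of_pos (by positivity : 0 < v ^ 2 + N)]
    gcongr
    nlinarith [sq_nonneg v]
  have b2 : |t * (v + t) / ((v ^ 2 + N) * (t ^ 2 + N))| ≤ 2 / N := by
    rw [abs_div, abs_of_pos (by positivity : 0 < (v ^ 2 + N) * (t ^ 2 + N)),
      div_le_div_iff₀ (by positivity) hNpos]
    have : |t * (v + t)| ≤ v ^ 2 + 2 * t ^ 2 := by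
      rw [abs_le]
      constructor <;>
        nlinarith [sq_nonneg (v + t), sq_nonneg (v - t), sq_nonneg t, sq_nonneg v]
    nlinarith [mul_nonneg (sq_nonneg v) (sq_nonneg t), mul_le_mul_of_nonneg_right this hNpos.le,
      mul_nonneg (sq_nonneg v) hNpos.le]
  have b3 : |y / (v ^ 2 + N) + x * (t * (v + t) / ((v ^ 2 + N) * (t ^ 2 + N)))| ≤ 3 / N := by
    refine (abs_add_le _ _).trans ?_
    rw [abs_mul]
    have := mul_le_mul hx b2 (abs_nonneg _) zero_le_one
    calc _ ≤ 1 / N + 1 * (2 / N) := add_le_add b1 this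
      _ = 3 / N := by ring
  rw [e4, abs_mul (r * s), abs_mul ((1 - r) ^ 2), abs_of_pos (by positivity : 0 < r * s),
    abs_of_nonneg (by positivity : 0 ≤ (1 - r) ^ 2)]
  calc r * s * ((1 - r) ^ 2 * |y / (v ^ 2 + N) + x * (t * (v + t) / ((v ^ 2 + N) * (t ^ 2 + N)))|)
      ≤ r * s * ((1 - r) ^ 2 * (3 / N)) := by gcongr
    _ = r / (1 + r) ^ 2 * (3 / s) := by
      have : N = (1 - r) ^ 2 * (1 + r) ^ 2 * s ^ 2 := by rw [hN]; ring
      have h3 : 1 - r ≠ 0 := by linarith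
      rw [this]; field_simp
    _ ≤ 1 * (3 / s) := by
      gcongr
      rw [div_le_one (by positivity)]
      nlinarith
    _ = 3 / s := one_mul _

lemma tendsto_kernel_add {s x y : ℝ} (hxy : x ≠ y) :
    Tendsto (fun r : ℝ => r * s * ((1 + r ^ 2) * y - 2 * r * x) /
        (((1 + r ^ 2) * x - 2 * r * y) ^ 2 + (1 - r ^ 2) ^ 2 * s ^ 2) +
      s / 2 * ((x - y) / ((x - y) ^ 2 + ((1 - r ^ 2) * s / (2 * r)) ^ 2))) (𝓝[<] 1) (𝓝 0) := by
  have h := sub_ne_zero.2 hxy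
  have e2 : ((1 + (1 : ℝ) ^ 2) * x - 2 * 1 * y) ^ 2 + (1 - 1 ^ 2) ^ 2 * s ^ 2 =
      4 * (x - y) ^ 2 := by ring
  have e3 : (x - y) ^ 2 + ((1 - (1 : ℝ) ^ 2) * s / (2 * 1)) ^ 2 = (x - y) ^ 2 := by ring
  have h2 : ((1 + (1 : ℝ) ^ 2) * x - 2 * 1 * y) ^ 2 + (1 - 1 ^ 2) ^ 2 * s ^ 2 ≠ 0 := by
    rw [e2]; positivity
  have h3 : (x - y) ^ 2 + ((1 - (1 : ℝ) ^ 2) * s / (2 * 1)) ^ 2 ≠ 0 := by positivity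
  have hc : ContinuousAt (fun r : ℝ => r * s * ((1 + r ^ 2) * y - 2 * r * x) /
        (((1 + r ^ 2) * x - 2 * r * y) ^ 2 + (1 - r ^ 2) ^ 2 * s ^ 2) +
      s / 2 * ((x - y) / ((x - y) ^ 2 + ((1 - r ^ 2) * s / (2 * r)) ^ 2))) 1 := by
    fun_prop (disch := first | assumption | norm_num)
  have := hc.tendsto
  refine (Tendsto.mono_left ?_ nhdsWithin_le_nhds)
  convert this using 2
  rw [e2, e3]
  field_simp
  ring

lemma integral_cos_natCast_sub_mul {n m : ℕ} :
    ∫ θ in 0..π, cos (((n : ℤ) - m : ℤ) * θ) = if n = m then π else 0 := by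
  have h := Polynomial.Chebyshev.integral_measureT_eq_integral_cos
    (f := fun x => (Polynomial.Chebyshev.T ℝ ((n : ℤ) - m)).eval x)
  simp only [Polynomial.Chebyshev.T_real_cos] at h
  rw [← h]
  split_ifs with hnm
  · rw [hnm, sub_self, Polynomial.Chebyshev.integral_eval_T_real_measureT_zero]
  · exact Polynomial.Chebyshev.integral_eval_T_real_measureT_of_ne_zero (by omega)

lemma integral_sin_mul_sin {n m : ℕ} (hn : n ≠ 0) :
    ∫ θ in 0..π, sin (m * θ) * sin (n * θ) = if n = m then π / 2 else 0 := by
  have h1 := integral_cos_natCast_sub_mul (n := n) (m := m)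
  have h2 : ∫ θ in 0..π, cos (((n : ℤ) + m : ℤ) * θ) = 0 := by
    have h := Polynomial.Chebyshev.integral_measureT_eq_integral_cos
      (f := fun x => (Polynomial.Chebyshev.T ℝ ((n : ℤ) + m)).eval x)
    simp only [Polynomial.Chebyshev.T_real_cos] at h
    rw [← h]
    exact Polynomial.Chebyshev.integral_eval_T_real_measureT_of_ne_zero (by omega)
  have h3 : ∀ θ : ℝ, sin (m * θ) * sin (n * θ) =
      (cos (((n : ℤ) - m : ℤ) * θ) - cos (((n : ℤ) + m : ℤ) * θ)) / 2 := fun θ => by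
    push_cast
    rw [sub_mul, add_mul, cos_sub, cos_add]
    ring
  simp only [h3]
  rw [intervalIntegral.integral_div, intervalIntegral.integral_sub
    (Continuous.intervalIntegrable (by fun_prop) _ _)
    (Continuous.intervalIntegrable (by fun_prop) _ _), h1, h2]
  split_ifs <;> simp

lemma norm_mul_sin_le (c t : ℝ) : ‖c * sin t‖ ≤ |c| := by
  rw [norm_mul, Real.norm_eq_abs, Real.norm_eq_abs]
  exact mul_le_of_le_one_right (abs_nonneg _) (abs_sin_le_one _)

lemma continuous_tsum_mul_sin {c : ℕ → ℝ} (hc : Summable fun n => |c n|) :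
    Continuous fun θ : ℝ => ∑' n, c n * sin (n * θ) :=
  continuous_tsum (fun n => by fun_prop) hc fun n θ => norm_mul_sin_le _ _

lemma hasSum_integral_mul_sin {c : ℕ → ℝ} (hc : Summable fun n => |c n|) {g : ℝ → ℝ}
    (hg : Continuous g) :
    HasSum (fun n => c n * ∫ θ in 0..π, g θ * sin (n * θ))
      (∫ θ in 0..π, g θ * ∑' n, c n * sin (n * θ)) := by
  have h := intervalIntegral.hasSum_integral_of_dominated_convergence (μ := volume)
    (a := 0) (b := π)
    (F := fun n θ => c n * (g θ * sin (n * θ))) (f := fun θ => g θ * ∑' n, c n * sin (n * θ))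
    (fun n θ => |c n| * |g θ|)
    (fun n => Continuous.aestronglyMeasurable (by fun_prop))
    (fun n => ae_of_all _ fun θ _ => by
      rw [mul_left_comm, mul_comm, norm_mul, Real.norm_eq_abs (g θ)]
      gcongr
      exact norm_mul_sin_le _ _)
    (ae_of_all _ fun θ _ => hc.mul_right _)
    (by
      simp only [tsum_mul_right]
      exact Continuous.intervalIntegrable (by fun_prop) _ _)
    (ae_of_all _ fun θ _ => by
      have := ((hc.of_norm_bounded fun n => norm_mul_sin_le (c n) (n * θ)).hasSum).mul_left (g θ)
      simpa only [mul_left_comm] using this)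
  simpa only [intervalIntegral.integral_const_mul] using h

/-- Parseval's identity for absolutely convergent sine series. -/
lemma hasSum_integral_tsum_sin_sq {c : ℕ → ℝ} (hc : Summable fun n => |c n|) (h0 : c 0 = 0) :
    HasSum (fun n => π / 2 * c n ^ 2) (∫ θ in 0..π, (∑' n, c n * sin (n * θ)) ^ 2) := by
  have h1 : ∀ m : ℕ, m ≠ 0 →
      ∫ θ in 0..π, (∑' n, c n * sin (n * θ)) * sin (m * θ) = c m * (π / 2) := fun m hm => by
    have h := hasSum_integral_mul_sin hc (g := fun θ => sin (m * θ)) (by fun_prop)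
    have h' : HasSum (fun n => c n * ∫ θ in 0..π, sin (m * θ) * sin (n * θ)) (c m * (π / 2)) := by
      have h'' := hasSum_ite_eq m (c m * (π / 2))
      convert! h'' using 2 with n
      rcases eq_or_ne n 0 with rfl | hn
      · simp [h0, hm.symm]
      · rw [integral_sin_mul_sin hn]
        split_ifs with h <;> simp [h]
    rw [← h.unique h']
    simp only [mul_comm]
  have h := hasSum_integral_mul_sin hc (continuous_tsum_mul_sin hc)
  simp only [← sq] at h
  convert! h using 2 with n
  rcases eq_or_ne n 0 with rfl | hn
  · simp [h0]
  · rw [h1 n hn]; ring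

lemma integrableOn_of_sq_mul_sqrt {f : ℝ → ℝ}
    (hmeas : AEStronglyMeasurable f (volume.restrict (Ioo (-1 : ℝ) 1)))
    (hL2 : IntegrableOn (fun x => f x ^ 2 * √(1 - x ^ 2)) (Ioo (-1 : ℝ) 1)) :
    IntegrableOn f (Ioo (-1 : ℝ) 1) := by
  have hw : IntegrableOn (fun x : ℝ => √(1 - x ^ 2)⁻¹) (Ioo (-1 : ℝ) 1) :=
    ((intervalIntegrable_iff_integrableOn_Ioo_of_le (by norm_num)).1
      Polynomial.Chebyshev.intervalIntegrable_sqrt_one_sub_sq_inv)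
  refine Integrable.mono (hL2.add hw) hmeas ?_
  filter_upwards [ae_restrict_mem measurableSet_Ioo] with x hx
  have hpos : 0 < 1 - x ^ 2 := by nlinarith [hx.1, hx.2]
  have hs := Real.sqrt_pos.2 hpos
  simp only [Pi.add_apply, Real.sqrt_inv]
  set w := √(1 - x ^ 2)
  rw [Real.norm_of_nonneg (by positivity : 0 ≤ f x ^ 2 * w + w⁻¹), Real.norm_eq_abs,
    ← sq_abs (f x)]
  have : |f x| ^ 2 * w + w⁻¹ - |f x| = w * ((|f x| - w⁻¹ / 2) ^ 2 + 3 / 4 * w⁻¹ ^ 2) := by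
    field_simp; ring
  have : 0 ≤ |f x| ^ 2 * w + w⁻¹ - |f x| := by rw [this]; positivity
  linarith

/-- The Chebyshev moments of `f` on `(-1,1)`, with the zeroth one replaced by `0`. -/
noncomputable def chebyshevMoment (f : ℝ → ℝ) (n : ℕ) : ℝ :=
  if n = 0 then 0 else ∫ x in Ioo (-1 : ℝ) 1, f x * (Polynomial.Chebyshev.T ℝ n).eval x

lemma integrableOn_mul_eval {f : ℝ → ℝ} (hf : IntegrableOn f (Ioo (-1 : ℝ) 1))
    (p : Polynomial ℝ) : IntegrableOn (fun x => f x * p.eval x) (Ioo (-1 : ℝ) 1) := by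
  obtain ⟨C, hC⟩ := isCompact_Icc.exists_bound_of_continuousOn (s := Icc (-1 : ℝ) 1)
    p.continuous.continuousOn
  refine hf.mul_bdd (c := C) p.continuous.aestronglyMeasurable ?_
  filter_upwards [ae_restrict_mem measurableSet_Ioo] with x hx
  exact hC x (Ioo_subset_Icc_self hx)

lemma setIntegral_mul_inv_sqrt_eq (f : ℝ → ℝ) :
    ∫ x in Ioo (-1 : ℝ) 1, f x * (√(1 - x ^ 2))⁻¹ =
      ∫ x, f x ∂Polynomial.Chebyshev.measureT := by
  rw [Polynomial.Chebyshev.integral_measureT, intervalIntegral.integral_of_le (by norm_num),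
    integral_Ioc_eq_integral_Ioo]
  simp only [Real.sqrt_inv]

/-- Bessel's inequality for the Chebyshev expansion. -/
lemma sum_chebyshevMoment_sq_le {f : ℝ → ℝ}
    (hmeas : AEStronglyMeasurable f (volume.restrict (Ioo (-1 : ℝ) 1)))
    (hL2 : IntegrableOn (fun x => f x ^ 2 * √(1 - x ^ 2)) (Ioo (-1 : ℝ) 1)) (s : Finset ℕ) :
    ∑ n ∈ s, chebyshevMoment f n ^ 2 ≤
      π / 2 * ∫ x in Ioo (-1 : ℝ) 1, f x ^ 2 * √(1 - x ^ 2) := by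
  have hf := integrableOn_of_sq_mul_sqrt hmeas hL2
  set b := chebyshevMoment f with hb
  set P : Polynomial ℝ := ∑ n ∈ s, Polynomial.C (2 / π * b n) * Polynomial.Chebyshev.T ℝ n with hP
  have hPe : ∀ x, P.eval x = ∑ n ∈ s, 2 / π * b n * (Polynomial.Chebyshev.T ℝ n).eval x := by
    intro x; simp [hP, Polynomial.eval_finsetSum]
  have hw : IntegrableOn (fun x : ℝ => (√(1 - x ^ 2))⁻¹) (Ioo (-1 : ℝ) 1) := by
    simpa only [Real.sqrt_inv] using
      ((intervalIntegrable_iff_integrableOn_Ioo_of_le (by norm_num)).1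
        Polynomial.Chebyshev.intervalIntegrable_sqrt_one_sub_sq_inv)
  have hfP : ∫ x in Ioo (-1 : ℝ) 1, f x * P.eval x = 2 / π * ∑ n ∈ s, b n ^ 2 := by
    have : ∀ x, f x * P.eval x =
        ∑ n ∈ s, 2 / π * b n * (f x * (Polynomial.Chebyshev.T ℝ n).eval x) := fun x => by
      rw [hPe, Finset.mul_sum]
      exact Finset.sum_congr rfl fun n _ => by ring
    simp only [this]
    rw [integral_finsetSum _ fun n _ => (integrableOn_mul_eval hf _).const_mul _, Finset.mul_sum]
    refine Finset.sum_congr rfl fun n _ => ?_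
    rw [integral_const_mul]
    rcases eq_or_ne n 0 with rfl | hn
    · simp [hb, chebyshevMoment]
    · have : b n = ∫ x in Ioo (-1 : ℝ) 1, f x * (Polynomial.Chebyshev.T ℝ n).eval x := by
        simp [hb, chebyshevMoment, hn]
      rw [← this]; ring
  have hPP : ∫ x in Ioo (-1 : ℝ) 1, (√(1 - x ^ 2))⁻¹ * (P * P).eval x =
      2 / π * ∑ n ∈ s, b n ^ 2 := by
    simp only [mul_comm (√_)⁻¹]
    rw [setIntegral_mul_inv_sqrt_eq]
    have : ∀ x, (P * P).eval x = ∑ n ∈ s, ∑ m ∈ s, 2 / π * b n * (2 / π * b m) *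
        ((Polynomial.Chebyshev.T ℝ n).eval x * (Polynomial.Chebyshev.T ℝ m).eval x) := fun x => by
      rw [Polynomial.eval_mul, hPe, Finset.sum_mul_sum]
      exact Finset.sum_congr rfl fun n _ => Finset.sum_congr rfl fun m _ => by ring
    simp only [this]
    have hint : ∀ n m : ℕ, Integrable (fun x => 2 / π * b n * (2 / π * b m) *
        ((Polynomial.Chebyshev.T ℝ n).eval x * (Polynomial.Chebyshev.T ℝ m).eval x))
        Polynomial.Chebyshev.measureT := fun n m =>
      Polynomial.Chebyshev.integrable_measureT (by fun_prop)
    rw [integral_finsetSum _ fun n _ => integrable_finsetSum _ fun m _ => hint n m, Finset.mul_sum]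
    refine Finset.sum_congr rfl fun n hn => ?_
    rw [integral_finsetSum _ fun m _ => hint n m, Finset.sum_eq_single n]
    · rw [integral_const_mul]
      rcases eq_or_ne n 0 with rfl | hn0
      · simp [hb, chebyshevMoment]
      · rw [Polynomial.Chebyshev.integral_T_real_mul_self_measureT_of_ne_zero hn0]
        field_simp
    · intro m _ hmn
      rw [integral_const_mul,
        Polynomial.Chebyshev.integral_eval_T_real_mul_eval_T_real_measureT_of_ne hmn.symm, mul_zero]
    · exact fun h => absurd hn h
  have hnonneg : 0 ≤ ∫ x in Ioo (-1 : ℝ) 1,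
      (f x ^ 2 * √(1 - x ^ 2) - 2 * (f x * P.eval x) + (√(1 - x ^ 2))⁻¹ * (P * P).eval x) := by
    refine setIntegral_nonneg measurableSet_Ioo fun x hx => ?_
    have hpos : 0 < 1 - x ^ 2 := by nlinarith [hx.1, hx.2]
    have hs := Real.sqrt_pos.2 hpos
    rw [Polynomial.eval_mul]
    set w := √(1 - x ^ 2)
    have : f x ^ 2 * w - 2 * (f x * P.eval x) + w⁻¹ * (P.eval x * P.eval x) =
        w * (f x - w⁻¹ * P.eval x) ^ 2 := by field_simp; ring
    rw [this]; positivity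
  have hsub : IntegrableOn (fun x => f x ^ 2 * √(1 - x ^ 2) - 2 * (f x * P.eval x))
      (Ioo (-1 : ℝ) 1) := hL2.sub ((integrableOn_mul_eval hf P).const_mul 2)
  rw [integral_add hsub (integrableOn_mul_eval hw _),
    integral_sub hL2 ((integrableOn_mul_eval hf P).const_mul 2), integral_const_mul,
    hfP, hPP] at hnonneg
  have h := mul_nonneg (by positivity : 0 ≤ π / 2) hnonneg
  have e : π / 2 * (2 / π) = 1 := by field_simp
  linear_combination h - (∑ n ∈ s, b n ^ 2) * e

lemma summable_chebyshevMoment_sq {f : ℝ → ℝ}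
    (hmeas : AEStronglyMeasurable f (volume.restrict (Ioo (-1 : ℝ) 1)))
    (hL2 : IntegrableOn (fun x => f x ^ 2 * √(1 - x ^ 2)) (Ioo (-1 : ℝ) 1)) :
    Summable fun n => chebyshevMoment f n ^ 2 :=
  summable_of_sum_le (fun _ => sq_nonneg _) (sum_chebyshevMoment_sq_le hmeas hL2)

lemma summable_abs_mul_pow {b : ℕ → ℝ} (hb : Summable fun n => b n ^ 2) {r : ℝ} (h0 : 0 < r)
    (h1 : r < 1) : Summable fun n => |b n * r ^ n| := by
  have hr : Summable fun n : ℕ => (r ^ 2) ^ n :=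
    summable_geometric_of_lt_one (by positivity) (by nlinarith)
  refine Summable.of_nonneg_of_le (fun n => abs_nonneg _) (fun n => ?_) (hb.add hr)
  rw [← pow_mul, mul_comm 2, pow_mul, abs_le]
  constructor <;> nlinarith [sq_nonneg (b n + r ^ n), sq_nonneg (b n - r ^ n)]

/-- The conjugate Abel means of the Chebyshev series of `f` as an integral. -/
lemma tsum_chebyshevMoment_eq {f : ℝ → ℝ} (hf : IntegrableOn f (Ioo (-1 : ℝ) 1)) {r θ : ℝ}
    (h0 : 0 < r) (h1 : r < 1) (hs : 0 < sin θ) :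
    ∑' n, chebyshevMoment f n * r ^ n * sin (n * θ) =
      ∫ y in Ioo (-1 : ℝ) 1, f y * (r * sin θ * ((1 + r ^ 2) * y - 2 * r * cos θ) /
        (((1 + r ^ 2) * cos θ - 2 * r * y) ^ 2 + (1 - r ^ 2) ^ 2 * sin θ ^ 2)) := by
  set F : ℕ → ℝ → ℝ := fun n y => f y * (r ^ n * sin (n * θ) * cos (n * arccos y)) with hF
  have hb : ∀ n : ℕ, ∀ y, ‖r ^ n * sin (n * θ) * cos (n * arccos y)‖ ≤ r ^ n := fun n y => by
    rw [norm_mul, norm_mul, norm_pow, Real.norm_of_nonneg h0.le, Real.norm_eq_abs,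
      Real.norm_eq_abs, mul_assoc]
    exact mul_le_of_le_one_right (by positivity)
      (mul_le_one₀ (abs_sin_le_one _) (abs_nonneg _) (abs_cos_le_one _))
  have hFint : ∀ n, Integrable (F n) (volume.restrict (Ioo (-1 : ℝ) 1)) := fun n =>
    Integrable.mul_bdd (c := r ^ n) hf
      (Continuous.aestronglyMeasurable (by fun_prop)) (ae_of_all _ (hb n))
  have hFn : ∀ n, ∫ y in Ioo (-1 : ℝ) 1, F n y = chebyshevMoment f n * r ^ n * sin (n * θ) :=
    fun n => by
    rcases eq_or_ne n 0 with rfl | hn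
    · simp [hF]
    · rw [chebyshevMoment, if_neg hn, mul_assoc, ← integral_mul_const]
      refine setIntegral_congr_fun measurableSet_Ioo fun y hy => ?_
      have := Polynomial.Chebyshev.T_real_cos (arccos y) n
      rw [cos_arccos hy.1.le hy.2.le] at this
      simp only [hF, this, Int.cast_natCast]
      ring
  have hsum : Summable fun n => ∫ y in Ioo (-1 : ℝ) 1, ‖F n y‖ := by
    refine Summable.of_nonneg_of_le (fun n => by positivity) (fun n => ?_)
      ((summable_geometric_of_lt_one h0.le h1).mul_left (∫ y in Ioo (-1 : ℝ) 1, ‖f y‖))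
    rw [← integral_mul_const]
    refine integral_mono (hFint n).norm (hf.norm.mul_const _) fun y => ?_
    simp only [hF]
    rw [norm_mul (f y)]
    gcongr
    exact hb n y
  have h := hasSum_integral_of_summable_integral_norm hFint hsum
  simp only [hFn] at h
  rw [h.tsum_eq]
  refine setIntegral_congr_fun measurableSet_Ioo fun y hy => ?_
  have := (hasSum_pow_mul_sin_mul_cos h0 h1 hs (arccos y)).mul_left (f y)
  rw [cos_arccos hy.1.le hy.2.le] at this
  exact this.tsum_eq

lemma tendsto_tsum_chebyshevMoment {f : ℝ → ℝ} (hf : IntegrableOn f (Ioo (-1 : ℝ) 1)) {θ : ℝ}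
    (hs : 0 < sin θ) (hH : HasFiniteHilbertAt f (cos θ) 0) :
    Tendsto (fun r : ℝ => ∑' n, chebyshevMoment f n * r ^ n * sin (n * θ)) (𝓝[<] 1) (𝓝 0) := by
  set s := sin θ with hsdef
  set x := cos θ with hx
  have hlt : ∀ᶠ r in 𝓝[<] (1 : ℝ), 0 < r ∧ r < 1 :=
    (Ioo_mem_nhdsLT zero_lt_one : Ioo (0 : ℝ) 1 ∈ 𝓝[<] (1 : ℝ))
  set k : ℝ → ℝ → ℝ := fun r y => (x - y) / ((x - y) ^ 2 + ((1 - r ^ 2) * s / (2 * r)) ^ 2) with hk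
  set K : ℝ → ℝ → ℝ := fun r y => r * s * ((1 + r ^ 2) * y - 2 * r * x) /
        (((1 + r ^ 2) * x - 2 * r * y) ^ 2 + (1 - r ^ 2) ^ 2 * s ^ 2) with hK
  have hδ : Tendsto (fun r : ℝ => (1 - r ^ 2) * s / (2 * r)) (𝓝[<] 1) (𝓝[>] 0) := by
    refine tendsto_nhdsWithin_iff.2 ⟨Tendsto.mono_left ?_ nhdsWithin_le_nhds, ?_⟩
    · have : ContinuousAt (fun r : ℝ => (1 - r ^ 2) * s / (2 * r)) 1 := by
        fun_prop (disch := norm_num)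
      simpa using this.tendsto
    · filter_upwards [hlt] with r hr
      have : 0 < 1 - r ^ 2 := by nlinarith [hr.1, hr.2]
      have := hr.1
      exact mem_Ioi.2 (by positivity)
  have hA := ((hH.tendsto_regularized hf).comp hδ).const_mul (s / 2)
  have hE : Tendsto (fun r => ∫ y in Ioo (-1 : ℝ) 1, f y * (K r y + s / 2 * k r y)) (𝓝[<] 1)
      (𝓝 (∫ y in Ioo (-1 : ℝ) 1, (0 : ℝ))) := by
    refine tendsto_integral_filter_of_dominated_convergence (fun y => |f y| * (3 / s)) ?_ ?_
      (hf.abs.mul_const _) ?_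
    · refine Eventually.of_forall fun r => hf.aestronglyMeasurable.mul ?_
      exact Measurable.aestronglyMeasurable (by fun_prop)
    · filter_upwards [hlt] with r hr
      filter_upwards [ae_restrict_mem measurableSet_Ioo] with y hy
      rw [norm_mul, Real.norm_eq_abs, Real.norm_eq_abs]
      gcongr
      exact abs_kernel_add_le hr.1 hr.2 hs (abs_cos_le_one θ) (abs_le.2 ⟨hy.1.le, hy.2.le⟩)
    · have hne : ∀ᵐ y : ℝ ∂volume.restrict (Ioo (-1 : ℝ) 1), y ≠ x :=
        ae_restrict_of_ae (Measure.ae_ne volume x)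
      filter_upwards [hne] with y hy
      simpa using! (tendsto_kernel_add hy.symm).const_mul (f y)
  have h := hE.sub hA
  simp only [integral_zero, mul_zero, sub_zero] at h
  refine h.congr' ?_
  filter_upwards [hlt] with r hr
  rw [tsum_chebyshevMoment_eq hf hr.1 hr.2 hs]
  have hD : 0 < (1 - r ^ 2) * s / (2 * r) := by
    have : 0 < 1 - r ^ 2 := by nlinarith [hr.1, hr.2]
    have := hr.1
    positivity
  have hkint : IntegrableOn (fun y => f y * (s / 2 * k r y)) (Ioo (-1 : ℝ) 1) := by
    have hc : Continuous (fun y => s / 2 * k r y) := by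
      simp only [hk]
      fun_prop (disch := intro y; positivity)
    obtain ⟨C, hC⟩ := isCompact_Icc.exists_bound_of_continuousOn (s := Icc (-1 : ℝ) 1)
      hc.continuousOn
    refine Integrable.mul_bdd (c := C) hf hc.aestronglyMeasurable ?_
    filter_upwards [ae_restrict_mem measurableSet_Ioo] with y hy
    exact hC y (Ioo_subset_Icc_self hy)
  have hEint : IntegrableOn (fun y => f y * (K r y + s / 2 * k r y)) (Ioo (-1 : ℝ) 1) := by
    refine Integrable.mul_bdd (c := 3 / s) hf (Measurable.aestronglyMeasurable (by fun_prop)) ?_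
    filter_upwards [ae_restrict_mem measurableSet_Ioo] with y hy
    exact abs_kernel_add_le hr.1 hr.2 hs (abs_cos_le_one θ) (abs_le.2 ⟨hy.1.le, hy.2.le⟩)
  simp only [Function.comp]
  rw [← integral_const_mul, ← integral_sub hEint]
  · refine integral_congr_ae (ae_of_all _ fun y => ?_)
    simp only [hK, hk]
    ring
  · exact hkint.congr (ae_of_all _ fun y => by simp only [hk]; ring)

/-- A property holding almost everywhere on `(-1,1)` holds at `cos θ` for almost every `θ`. -/
lemma ae_cos_of_ae {p : ℝ → Prop} (h : ∀ᵐ x ∂volume.restrict (Ioo (-1 : ℝ) 1), p x) :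
    ∀ᵐ θ ∂volume.restrict (Ioo 0 π), p (cos θ) := by
  have h0 : volume {x | x ∈ Ioo (-1 : ℝ) 1 ∧ ¬ p x} = 0 := by
    rw [ae_restrict_iff' measurableSet_Ioo, ae_iff] at h
    simpa [and_assoc] using h
  have h1 := addHaar_image_eq_zero_of_differentiableOn_of_addHaar_eq_zero volume (f := arccos)
    (fun x hx => (differentiableAt_arccos.2
      ⟨hx.1.1.ne', hx.1.2.ne⟩).differentiableWithinAt) h0
  rw [ae_restrict_iff' measurableSet_Ioo, ae_iff]
  refine measure_mono_null (fun θ hθ => ?_) h1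
  simp only [Classical.not_imp, mem_ofPred_eq] at hθ
  refine ⟨cos θ, ⟨⟨?_, ?_⟩, hθ.2⟩, arccos_cos hθ.1.1.le hθ.1.2.le⟩
  · rw [← cos_pi]
    exact cos_lt_cos_of_nonneg_of_le_pi hθ.1.1.le le_rfl hθ.1.2
  · rw [← cos_zero]
    exact cos_lt_cos_of_nonneg_of_le_pi le_rfl hθ.1.2.le hθ.1.1

/-- If the Abel means of a square summable sine series tend to `0` almost everywhere, then all
its coefficients vanish. -/
lemma eq_zero_of_tendsto_abel_sin {b : ℕ → ℝ} (hb : Summable fun n => b n ^ 2) (hb0 : b 0 = 0)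
    (h : ∀ᵐ θ ∂volume.restrict (Ioo 0 π),
      Tendsto (fun r : ℝ => ∑' n, b n * r ^ n * sin (n * θ)) (𝓝[<] 1) (𝓝 0)) (m : ℕ) :
    b m = 0 := by
  set u : ℝ → ℝ → ℝ := fun r θ => ∑' n, b n * r ^ n * sin (n * θ) with hu
  have hlt : ∀ᶠ r in 𝓝[<] (1 : ℝ), 0 < r ∧ r < 1 :=
    (Ioo_mem_nhdsLT zero_lt_one : Ioo (0 : ℝ) 1 ∈ 𝓝[<] (1 : ℝ))
  obtain ⟨τ, -, hτ, hτ1⟩ := exists_seq_strictMono_tendsto' (zero_lt_one : (0 : ℝ) < 1)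
  have hτlim : Tendsto τ atTop (𝓝[<] 1) :=
    tendsto_nhdsWithin_iff.2 ⟨hτ1, Eventually.of_forall fun k => (hτ k).2⟩
  have hcont : ∀ r, 0 < r → r < 1 → Continuous (u r) := fun r h0 h1 =>
    continuous_tsum_mul_sin (summable_abs_mul_pow hb h0 h1)
  have hlint : ∀ g : ℝ → ℝ, Continuous g → ∫⁻ θ in Ioo 0 π, ENNReal.ofReal (g θ ^ 2) =
      ENNReal.ofReal (∫ θ in 0..π, g θ ^ 2) := fun g hg => by
    rw [intervalIntegral.integral_of_le pi_pos.le, integral_Ioc_eq_integral_Ioo,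
      ofReal_integral_eq_lintegral_ofReal _ (ae_of_all _ fun θ => sq_nonneg _)]
    exact ((hg.pow 2).continuousOn.integrableOn_Icc (a := 0) (b := π)).mono_set Ioo_subset_Icc_self
  have hbd : ∀ r, 0 < r → r < 1 → Summable fun n => π / 2 * (b n * (1 - r ^ n)) ^ 2 :=
    fun r h0 h1 => by
    refine Summable.mul_left _ (Summable.of_nonneg_of_le (fun n => sq_nonneg _) (fun n => ?_) hb)
    rw [mul_pow]
    have e1 := pow_pos h0 n
    have e2 := pow_le_one₀ (n := n) h0.le h1.le
    exact mul_le_of_le_one_right (sq_nonneg _) (pow_le_one₀ (by linarith) (by linarith))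
  have hmain : ∀ r, 0 < r → r < 1 →
      π / 2 * (b m * r ^ m) ^ 2 ≤ ∑' n, π / 2 * (b n * (1 - r ^ n)) ^ 2 := fun r h0 h1 => by
    have hP := hasSum_integral_tsum_sin_sq (summable_abs_mul_pow hb h0 h1) (by simp [hb0])
    refine (le_hasSum hP m fun n _ => by positivity).trans ?_
    have htsum : 0 ≤ ∑' n, π / 2 * (b n * (1 - r ^ n)) ^ 2 := tsum_nonneg fun n => by positivity
    rw [← ENNReal.ofReal_le_ofReal_iff htsum, ← hlint (u r) (hcont r h0 h1)]
    calc ∫⁻ θ in Ioo 0 π, ENNReal.ofReal (u r θ ^ 2)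
        = ∫⁻ θ in Ioo 0 π, liminf (fun k => ENNReal.ofReal ((u r θ - u (τ k) θ) ^ 2)) atTop := by
          refine lintegral_congr_ae ?_
          filter_upwards [h] with θ hθ
          refine (Tendsto.liminf_eq ?_).symm
          have := ((tendsto_const_nhds (x := u r θ)).sub (hθ.comp hτlim)).pow 2
          rw [sub_zero] at this
          exact ENNReal.tendsto_ofReal this
      _ ≤ liminf (fun k => ∫⁻ θ in Ioo 0 π, ENNReal.ofReal ((u r θ - u (τ k) θ) ^ 2)) atTop := by
          refine lintegral_liminf_le' fun k => ?_
          exact (((hcont r h0 h1).sub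
            (hcont _ (hτ k).1 (hτ k).2)).pow 2).measurable.ennreal_ofReal.aemeasurable
      _ ≤ ENNReal.ofReal (∑' n, π / 2 * (b n * (1 - r ^ n)) ^ 2) := by
          refine liminf_le_of_frequently_le' (Eventually.frequently ?_)
          filter_upwards [hτlim.eventually hlt, hτlim.eventually (Ioo_mem_nhdsLT h1)] with k ht hrt
          set t := τ k
          rw [hlint (fun θ => u r θ - u t θ) ((hcont r h0 h1).sub (hcont t ht.1 ht.2))]
          refine ENNReal.ofReal_le_ofReal ?_
          have hsr := summable_abs_mul_pow hb h0 h1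
          have hst := summable_abs_mul_pow hb ht.1 ht.2
          have hsub : Summable fun n => |b n * r ^ n - b n * t ^ n| :=
            (hsr.of_abs.sub hst.of_abs).abs
          have hQ := hasSum_integral_tsum_sin_sq hsub (by simp [hb0])
          have hdiff : ∀ θ, u r θ - u t θ = ∑' n, (b n * r ^ n - b n * t ^ n) * sin (n * θ) :=
            fun θ => by
            simp only [hu, sub_mul]
            exact (Summable.tsum_sub (hsr.of_norm_bounded fun n => norm_mul_sin_le _ _)
              (hst.of_norm_bounded fun n => norm_mul_sin_le _ _)).symm
          simp only [hdiff]
          refine hasSum_le (fun n => ?_) hQ (hbd r h0 h1).hasSum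
          rw [← mul_sub, mul_pow, mul_pow]
          gcongr π / 2 * (b n ^ 2 * ?_)
          have e1 := pow_le_pow_left₀ h0.le hrt.1.le n
          have e2 := pow_le_one₀ (n := n) ht.1.le ht.2.le
          nlinarith
  have hL : Tendsto (fun r : ℝ => π / 2 * (b m * r ^ m) ^ 2) (𝓝[<] 1)
      (𝓝 (π / 2 * (b m * 1 ^ m) ^ 2)) :=
    Tendsto.mono_left (Continuous.tendsto (by fun_prop) 1) nhdsWithin_le_nhds
  have hR : Tendsto (fun r : ℝ => ∑' n, π / 2 * (b n * (1 - r ^ n)) ^ 2) (𝓝[<] 1)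
      (𝓝 (∑' n : ℕ, π / 2 * (b n * (1 - 1 ^ n)) ^ 2)) := by
    refine tendsto_tsum_of_dominated_convergence (hb.mul_left (π / 2)) (fun n => ?_) ?_
    · exact Tendsto.mono_left (Continuous.tendsto (by fun_prop) 1) nhdsWithin_le_nhds
    · filter_upwards [hlt] with r hr n
      rw [Real.norm_of_nonneg (by positivity), mul_pow]
      gcongr
      have e1 := pow_pos hr.1 n
      have e2 := pow_le_one₀ (n := n) hr.1.le hr.2.le
      exact mul_le_of_le_one_right (sq_nonneg _) (pow_le_one₀ (by linarith) (by linarith))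
  have := le_of_tendsto_of_tendsto hL hR (hlt.mono fun r hr => hmain r hr.1 hr.2)
  simp only [one_pow, mul_one, sub_self, mul_zero, ne_eq, OfNat.ofNat_ne_zero, not_false_eq_true,
    zero_pow, tsum_zero] at this
  have h2 : b m ^ 2 ≤ 0 := by
    by_contra! hlt
    have : 0 < π / 2 * b m ^ 2 := by positivity
    linarith
  exact pow_eq_zero_iff two_ne_zero |>.1 (le_antisymm h2 (sq_nonneg _))

/-- An integrable function on `(-1,1)` with vanishing Chebyshev moments vanishes a.e. -/
lemma ae_eq_zero_of_chebyshev_moments {h : ℝ → ℝ} (hh : IntegrableOn h (Ioo (-1 : ℝ) 1))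
    (hT : ∀ n : ℕ, ∫ x in Ioo (-1 : ℝ) 1, h x * (Polynomial.Chebyshev.T ℝ n).eval x = 0) :
    ∀ᵐ x ∂volume.restrict (Ioo (-1 : ℝ) 1), h x = 0 := by
  have hpow : ∀ k : ℕ, ∀ n : ℤ, ∫ x in Ioo (-1 : ℝ) 1,
      h x * (Polynomial.X ^ k * Polynomial.Chebyshev.T ℝ n).eval x = 0 := fun k => by
    induction k with
    | zero =>
      intro n
      simpa only [pow_zero, one_mul, Polynomial.Chebyshev.T_natAbs] using hT n.natAbs
    | succ k ih =>
      intro n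
      have e : ∀ x, h x * (Polynomial.X ^ (k + 1) * Polynomial.Chebyshev.T ℝ n).eval x =
          (h x * (Polynomial.X ^ k * Polynomial.Chebyshev.T ℝ (n + 1)).eval x +
            h x * (Polynomial.X ^ k * Polynomial.Chebyshev.T ℝ (n - 1)).eval x) / 2 := fun x => by
        rw [Polynomial.Chebyshev.T_add_one]
        simp only [Polynomial.eval_mul, Polynomial.eval_pow, Polynomial.eval_X,
          Polynomial.eval_sub, Polynomial.eval_ofNat]
        ring
      simp only [e]
      rw [integral_div, integral_add (integrableOn_mul_eval hh _) (integrableOn_mul_eval hh _),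
        ih, ih]
      simp
  have hpoly : ∀ p : Polynomial ℝ, ∫ x in Ioo (-1 : ℝ) 1, h x * p.eval x = 0 := fun p => by
    induction p using Polynomial.induction_on' with
    | add p q hp hq =>
      simp only [Polynomial.eval_add, mul_add]
      rw [integral_add (integrableOn_mul_eval hh _) (integrableOn_mul_eval hh _), hp, hq, add_zero]
    | monomial n a =>
      have := hpow n 0
      simp only [Polynomial.Chebyshev.T_zero, mul_one, Polynomial.eval_pow,
        Polynomial.eval_X] at this
      simp only [Polynomial.eval_monomial, mul_left_comm _ a]
      rw [integral_const_mul, this, mul_zero]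
  have hcont : ∀ g : ℝ → ℝ, Continuous g → ∫ x in Ioo (-1 : ℝ) 1, h x * g x = 0 := fun g hg => by
    have hI : 0 ≤ ∫ x in Ioo (-1 : ℝ) 1, |h x| := by positivity
    refine abs_eq_zero.1 (le_antisymm (le_of_forall_pos_le_add fun ε hε => ?_) (abs_nonneg _))
    set η := ε / ((∫ x in Ioo (-1 : ℝ) 1, |h x|) + 1) with hη
    obtain ⟨p, hp⟩ := exists_polynomial_near_of_continuousOn (-1) 1 g hg.continuousOn η
      (by positivity)
    have hgint : IntegrableOn (fun x => h x * g x) (Ioo (-1 : ℝ) 1) := by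
      obtain ⟨C, hC⟩ := isCompact_Icc.exists_bound_of_continuousOn (s := Icc (-1 : ℝ) 1)
        hg.continuousOn
      refine Integrable.mul_bdd (c := C) hh hg.aestronglyMeasurable ?_
      filter_upwards [ae_restrict_mem measurableSet_Ioo] with x hx
      exact hC x (Ioo_subset_Icc_self hx)
    have e : ∫ x in Ioo (-1 : ℝ) 1, h x * g x =
        ∫ x in Ioo (-1 : ℝ) 1, (h x * g x - h x * p.eval x) := by
      rw [integral_sub hgint (integrableOn_mul_eval hh p), hpoly p, sub_zero]
    rw [e, zero_add]
    calc |∫ x in Ioo (-1 : ℝ) 1, (h x * g x - h x * p.eval x)|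
        ≤ ∫ x in Ioo (-1 : ℝ) 1, |h x| * η := by
          rw [← Real.norm_eq_abs]
          refine norm_integral_le_of_norm_le (hh.abs.mul_const _) ?_
          filter_upwards [ae_restrict_mem measurableSet_Ioo] with x hx
          rw [← mul_sub, norm_mul, Real.norm_eq_abs, Real.norm_eq_abs, abs_sub_comm]
          gcongr
          exact (hp x (Ioo_subset_Icc_self hx)).le
      _ = (∫ x in Ioo (-1 : ℝ) 1, |h x|) * η := integral_mul_const _ _
      _ ≤ ε := by
          rw [hη, mul_div_assoc', div_le_iff₀ (by positivity)]
          nlinarith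
  rw [ae_restrict_iff' measurableSet_Ioo]
  refine isOpen_Ioo.ae_eq_zero_of_integral_contDiff_smul_eq_zero hh.locallyIntegrableOn
    fun g hg _ hsupp => ?_
  rw [← setIntegral_eq_integral_of_forall_compl_eq_zero (s := Ioo (-1 : ℝ) 1)]
  · simpa only [smul_eq_mul, mul_comm] using hcont g hg.continuous
  · intro x hx
    rw [image_eq_zero_of_notMem_tsupport fun hx' => hx (hsupp hx'), zero_smul]

/-- **Tricomi's theorem.** If `f(x)(1-x²)^{1/4} ∈ L²(-1,1)` and the finite Hilbert
transform of `f` exists and vanishes a.e. on `(-1,1)`, then `f(x) = c/√(1-x²)` a.e. -/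
theorem tricomi_arcsine (f : ℝ → ℝ)
    (hmeas : AEStronglyMeasurable f (volume.restrict (Ioo (-1 : ℝ) 1)))
    (hL2 : IntegrableOn (fun x => f x ^ 2 * Real.sqrt (1 - x ^ 2)) (Ioo (-1 : ℝ) 1))
    (hH : ∀ᵐ x ∂(volume.restrict (Ioo (-1 : ℝ) 1)), HasFiniteHilbertAt f x 0) :
    ∃ c : ℝ, ∀ᵐ x ∂(volume.restrict (Ioo (-1 : ℝ) 1)),
      f x = c / Real.sqrt (1 - x ^ 2) := by
  have hf := integrableOn_of_sq_mul_sqrt hmeas hL2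
  have hmoment : ∀ n, chebyshevMoment f n = 0 :=
    eq_zero_of_tendsto_abel_sin (summable_chebyshevMoment_sq hmeas hL2)
      (by simp [chebyshevMoment]) (by
        filter_upwards [ae_cos_of_ae hH, ae_restrict_mem measurableSet_Ioo] with θ hθ hmem
        exact tendsto_tsum_chebyshevMoment hf (sin_pos_of_mem_Ioo hmem) hθ)
  set c := (∫ x in Ioo (-1 : ℝ) 1, f x) / π with hc
  have hw : IntegrableOn (fun x : ℝ => (√(1 - x ^ 2))⁻¹) (Ioo (-1 : ℝ) 1) := by
    simpa only [Real.sqrt_inv] using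
      ((intervalIntegrable_iff_integrableOn_Ioo_of_le (by norm_num)).1
        Polynomial.Chebyshev.intervalIntegrable_sqrt_one_sub_sq_inv)
  refine ⟨c, ?_⟩
  have hsub : IntegrableOn (fun x => f x - c * (√(1 - x ^ 2))⁻¹) (Ioo (-1 : ℝ) 1) :=
    hf.sub (hw.const_mul c)
  have hT : ∀ n : ℕ, ∫ x in Ioo (-1 : ℝ) 1,
      (f x - c * (√(1 - x ^ 2))⁻¹) * (Polynomial.Chebyshev.T ℝ n).eval x = 0 := fun n => by
    have e : ∀ x, (f x - c * (√(1 - x ^ 2))⁻¹) * (Polynomial.Chebyshev.T ℝ n).eval x =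
        f x * (Polynomial.Chebyshev.T ℝ n).eval x -
          c * ((Polynomial.Chebyshev.T ℝ n).eval x * (√(1 - x ^ 2))⁻¹) := fun x => by ring
    have hwT : IntegrableOn (fun x => (Polynomial.Chebyshev.T ℝ n).eval x * (√(1 - x ^ 2))⁻¹)
        (Ioo (-1 : ℝ) 1) :=
      (integrableOn_mul_eval hw (Polynomial.Chebyshev.T ℝ n)).congr
        (ae_of_all _ fun x => mul_comm _ _)
    simp only [e]
    rw [integral_sub (integrableOn_mul_eval hf _) (hwT.const_mul c), integral_const_mul,
      setIntegral_mul_inv_sqrt_eq]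
    rcases eq_or_ne n 0 with rfl | hn
    · rw [Nat.cast_zero, Polynomial.Chebyshev.integral_eval_T_real_measureT_zero, hc]
      simp
    · rw [Polynomial.Chebyshev.integral_eval_T_real_measureT_of_ne_zero (by exact_mod_cast hn)]
      have := hmoment n
      rw [chebyshevMoment, if_neg hn] at this
      rw [this]
      simp
  filter_upwards [ae_eq_zero_of_chebyshev_moments hsub hT] with x hx
  rw [div_eq_mul_inv]
  linarith
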